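/- Let U = CNOT be the two-qubit gate |0⟩⟨0| ⊗ I₂ + |1⟩⟨1| ⊗ σ_x on ℂ² ⊗ ℂ² (so N = 2). Then X(U) = 1/2, Y(U) = 1/4, e_p(U) = 2/9, g_t(U) = 2/3, and for every n ≥ 1 the averages over independent Haar-random interlacing local gates satisfy ⟨e_p(U^(n))⟩ = (1/5)·(1 − (−1)^n/9^n) and ⟨g_t(U^(n))⟩ = 1 − 3^{−n}, where U^(n) = U·W_{n−1}·U ⋯ W_1·U with W_j = U^A_j ⊗ U^B_j. -/

import Mathlib

open Matrix MeasureTheory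
open scoped Kronecker

noncomputable section

instance {m n R : Type*} [TopologicalSpace R] : MeasurableSpace (Matrix m n R) := borel _
instance {m n R : Type*} [TopologicalSpace R] : BorelSpace (Matrix m n R) := ⟨rfl⟩

/-- Reshuffling: `(U_R)_{(i,j),(α,β)} = U_{(i,α),(j,β)}`. -/
def reshuffle (N : ℕ) (U : Matrix (Fin N × Fin N) (Fin N × Fin N) ℂ) :
    Matrix (Fin N × Fin N) (Fin N × Fin N) ℂ :=
  Matrix.of fun p q => U (p.1, q.1) (p.2, q.2)

/-- Partial transpose: `(U_Γ)_{(j,α),(i,β)} = U_{(i,α),(j,β)}`. -/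
def ptransp (N : ℕ) (U : Matrix (Fin N × Fin N) (Fin N × Fin N) ℂ) :
    Matrix (Fin N × Fin N) (Fin N × Fin N) ℂ :=
  Matrix.of fun p q => U (q.1, p.2) (p.1, q.2)

/-- The swap gate `S(x ⊗ y) = y ⊗ x`. -/
def swapGate (N : ℕ) : Matrix (Fin N × Fin N) (Fin N × Fin N) ℂ :=
  Matrix.of fun p q => if p.1 = q.2 ∧ p.2 = q.1 then 1 else 0

/-- `ρ_R(U) = U_R U_R† / N²`. -/
def rhoR (N : ℕ) (U : Matrix (Fin N × Fin N) (Fin N × Fin N) ℂ) :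
    Matrix (Fin N × Fin N) (Fin N × Fin N) ℂ :=
  ((N : ℂ) ^ 2)⁻¹ • (reshuffle N U * (reshuffle N U)ᴴ)

/-- `ρ_T(U) = S U_Γ U_Γ† S / N²`. -/
def rhoT (N : ℕ) (U : Matrix (Fin N × Fin N) (Fin N × Fin N) ℂ) :
    Matrix (Fin N × Fin N) (Fin N × Fin N) ℂ :=
  ((N : ℂ) ^ 2)⁻¹ • (swapGate N * (ptransp N U * (ptransp N U)ᴴ) * swapGate N)

/-- Purity `X(U) = tr(ρ_R(U)²)` (a real number). -/
def Xpur (N : ℕ) (U : Matrix (Fin N × Fin N) (Fin N × Fin N) ℂ) : ℝ :=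
  ((rhoR N U * rhoR N U).trace).re

/-- Purity `Y(U) = tr(ρ_T(U)²)` (a real number). -/
def Ypur (N : ℕ) (U : Matrix (Fin N × Fin N) (Fin N × Fin N) ℂ) : ℝ :=
  ((rhoT N U * rhoT N U).trace).re

/-- Entangling power `e_p(U)`. -/
def ep (N : ℕ) (U : Matrix (Fin N × Fin N) (Fin N × Fin N) ℂ) : ℝ :=
  ((N : ℝ) ^ 2 / ((N : ℝ) + 1) ^ 2) *
    ((1 - Xpur N U) + (1 - Ypur N U) - ((N : ℝ) ^ 2 - 1) / (N : ℝ) ^ 2)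

/-- Gate typicality `g_t(U)`. -/
def gateTyp (N : ℕ) (U : Matrix (Fin N × Fin N) (Fin N × Fin N) ℂ) : ℝ :=
  ((N : ℝ) ^ 2 / ((N : ℝ) ^ 2 - 1)) *
    (Ypur N U - Xpur N U + ((N : ℝ) ^ 2 - 1) / (N : ℝ) ^ 2)

/-- Mean entangling power over the Haar measure, `ē_p = (N-1)²/(N²+1)`. -/
def epBar (N : ℕ) : ℝ := ((N : ℝ) - 1) ^ 2 / ((N : ℝ) ^ 2 + 1)

/-- `iterGate U W k = U · W_{k-1} · U ⋯ W_0 · U`, i.e. `U^(k+1)` with `k` interlacing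
local gates `W_0, …, W_{k-1}`. -/
def iterGate {D : Type*} [Fintype D] [DecidableEq D] (U : Matrix D D ℂ)
    (W : ℕ → Matrix D D ℂ) : ℕ → Matrix D D ℂ
  | 0 => U
  | k + 1 => U * W k * iterGate U W k

/-- The two-qubit CNOT gate `|0⟩⟨0| ⊗ I₂ + |1⟩⟨1| ⊗ σ_x`. -/
def cnot : Matrix (Fin 2 × Fin 2) (Fin 2 × Fin 2) ℂ :=
  (!![1, 0; 0, 0] : Matrix (Fin 2) (Fin 2) ℂ) ⊗ₖ (1 : Matrix (Fin 2) (Fin 2) ℂ) +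
    (!![0, 0; 0, 1] : Matrix (Fin 2) (Fin 2) ℂ) ⊗ₖ (!![0, 1; 1, 0] : Matrix (Fin 2) (Fin 2) ℂ)

/-- The three Pauli matrices. -/
def pauli : Fin 3 → Matrix (Fin 2) (Fin 2) ℂ :=
  ![!![0, 1; 1, 0], !![0, -Complex.I; Complex.I, 0], !![1, 0; 0, -1]]

/-- The partial trace over the second factor of the Heisenberg-evolved operator `V† P V`. -/
def reducedEvolution (V P : Matrix (Fin 2 × Fin 2) (Fin 2 × Fin 2) ℂ) :
    Matrix (Fin 2) (Fin 2) ℂ :=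
  Matrix.of fun l j => ∑ β, (Vᴴ * P * V) (l, β) (j, β)

/-- The quadratic form `P ↦ tr ((tr_B (V† P V))²)`. -/
def evolvedForm (V P : Matrix (Fin 2 × Fin 2) (Fin 2 × Fin 2) ℂ) : ℝ :=
  ((reducedEvolution V P * reducedEvolution V P).trace).re

lemma evolvedForm_mul (U V P : Matrix (Fin 2 × Fin 2) (Fin 2 × Fin 2) ℂ) :
    evolvedForm (U * V) P = evolvedForm V (Uᴴ * P * U) := by
  simp only [evolvedForm, reducedEvolution, conjTranspose_mul, Matrix.mul_assoc]

lemma evolvedForm_one {V : Matrix (Fin 2 × Fin 2) (Fin 2 × Fin 2) ℂ} (hV : Vᴴ * V = 1) :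
    evolvedForm V 1 = 8 := by
  simp only [evolvedForm, reducedEvolution, Matrix.mul_one, hV]
  simp [trace, Matrix.mul_apply, Matrix.one_apply]
  norm_num

lemma reducedEvolution_kronecker_one (V : Matrix (Fin 2 × Fin 2) (Fin 2 × Fin 2) ℂ)
    (P : Matrix (Fin 2) (Fin 2) ℂ) (l j : Fin 2) :
    reducedEvolution V (P ⊗ₖ 1) l j =
      ∑ k, ∑ i, P k i * (reshuffle 2 V * (reshuffle 2 V)ᴴ) (i, j) (k, l) := by
  simp [reducedEvolution, reshuffle, Matrix.mul_apply, Fintype.sum_prod_type, Fin.sum_univ_two,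
    Matrix.one_apply]
  ring

lemma reducedEvolution_one_kronecker (V : Matrix (Fin 2 × Fin 2) (Fin 2 × Fin 2) ℂ)
    (P : Matrix (Fin 2) (Fin 2) ℂ) (l j : Fin 2) :
    reducedEvolution V (1 ⊗ₖ P) l j =
      ∑ γ, ∑ α, P γ α * (ptransp 2 V * (ptransp 2 V)ᴴ) (j, α) (l, γ) := by
  simp [reducedEvolution, ptransp, Matrix.mul_apply, Fintype.sum_prod_type, Fin.sum_univ_two,
    Matrix.one_apply]
  ring

lemma swapGate_mul_self (N : ℕ) : swapGate N * swapGate N = 1 := by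
  ext ⟨i, α⟩ ⟨j, β⟩
  simp [swapGate, Matrix.mul_apply, Fintype.sum_prod_type, Matrix.one_apply, ite_and]

lemma Xpur_eq (N : ℕ) (V : Matrix (Fin N × Fin N) (Fin N × Fin N) ℂ) :
    Xpur N V = ((N : ℝ) ^ 4)⁻¹ * ((reshuffle N V * (reshuffle N V)ᴴ *
      (reshuffle N V * (reshuffle N V)ᴴ)).trace).re := by
  have h : ((N : ℂ) ^ 2)⁻¹ * ((N : ℂ) ^ 2)⁻¹ = (((N : ℝ) ^ 4)⁻¹ : ℝ) := by
    push_cast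
    rw [← mul_inv]
    ring
  rw [Xpur, rhoR, Matrix.smul_mul, Matrix.mul_smul, smul_smul, h, trace_smul, smul_eq_mul,
    Complex.re_ofReal_mul]

lemma Ypur_eq (N : ℕ) (V : Matrix (Fin N × Fin N) (Fin N × Fin N) ℂ) :
    Ypur N V = ((N : ℝ) ^ 4)⁻¹ * ((ptransp N V * (ptransp N V)ᴴ *
      (ptransp N V * (ptransp N V)ᴴ)).trace).re := by
  have h : ((N : ℂ) ^ 2)⁻¹ * ((N : ℂ) ^ 2)⁻¹ = (((N : ℝ) ^ 4)⁻¹ : ℝ) := by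
    push_cast
    rw [← mul_inv]
    ring
  have hs : ∀ T, (swapGate N * T * swapGate N * (swapGate N * T * swapGate N)).trace
      = (T * T).trace := fun T => by
    rw [show swapGate N * T * swapGate N * (swapGate N * T * swapGate N)
        = swapGate N * T * (swapGate N * swapGate N) * T * swapGate N by
          simp only [Matrix.mul_assoc], swapGate_mul_self, Matrix.mul_one, trace_mul_comm,
        ← Matrix.mul_assoc, ← Matrix.mul_assoc, swapGate_mul_self, Matrix.one_mul]
  rw [Ypur, rhoT, Matrix.smul_mul, Matrix.mul_smul, smul_smul, h, trace_smul, smul_eq_mul,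
    Complex.re_ofReal_mul, hs]

lemma Xpur_eq_sum_evolvedForm (V : Matrix (Fin 2 × Fin 2) (Fin 2 × Fin 2) ℂ) :
    32 * Xpur 2 V = evolvedForm V 1 + ∑ i, evolvedForm V (pauli i ⊗ₖ 1) := by
  rw [Xpur_eq, ← one_kronecker_one]
  simp only [evolvedForm, ← Complex.re_sum, ← Complex.add_re]
  simp only [trace, diag, Matrix.mul_apply (n := Fin 2) (M := reducedEvolution _ _),
    reducedEvolution_kronecker_one]
  generalize reshuffle 2 V * (reshuffle 2 V)ᴴ = R
  rw [← mul_assoc, ← Complex.re_ofReal_mul]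
  congr 1
  simp [pauli, Matrix.mul_apply, Fintype.sum_prod_type, Fin.sum_univ_two, Fin.sum_univ_three]
  ring_nf
  simp only [Complex.I_sq]
  ring

lemma Ypur_eq_sum_evolvedForm (V : Matrix (Fin 2 × Fin 2) (Fin 2 × Fin 2) ℂ) :
    32 * Ypur 2 V = evolvedForm V 1 + ∑ i, evolvedForm V (1 ⊗ₖ pauli i) := by
  rw [Ypur_eq, ← one_kronecker_one]
  simp only [evolvedForm, ← Complex.re_sum, ← Complex.add_re]
  simp only [trace, diag, Matrix.mul_apply (n := Fin 2) (M := reducedEvolution _ _),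
    reducedEvolution_one_kronecker]
  generalize ptransp 2 V * (ptransp 2 V)ᴴ = R
  rw [← mul_assoc, ← Complex.re_ofReal_mul]
  congr 1
  simp [pauli, Matrix.mul_apply, Fintype.sum_prod_type, Fin.sum_univ_two, Fin.sum_univ_three]
  ring_nf
  simp only [Complex.I_sq]
  ring

lemma reshuffle_kronecker_mul (N : ℕ) (a b : Matrix (Fin N) (Fin N) ℂ)
    (V : Matrix (Fin N × Fin N) (Fin N × Fin N) ℂ) :
    reshuffle N (a ⊗ₖ b * V) = (a ⊗ₖ 1) * reshuffle N V * (b ⊗ₖ 1)ᵀ := by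
  ext ⟨i, j⟩ ⟨α, β⟩
  simp [reshuffle, Matrix.mul_apply, Fintype.sum_prod_type, Matrix.one_apply, Finset.sum_mul]
  rw [Finset.sum_comm]
  exact Finset.sum_congr rfl fun _ _ => Finset.sum_congr rfl fun _ _ => by ring

lemma ptransp_kronecker_mul (N : ℕ) (a b : Matrix (Fin N) (Fin N) ℂ)
    (V : Matrix (Fin N × Fin N) (Fin N × Fin N) ℂ) :
    ptransp N (a ⊗ₖ b * V) = (1 ⊗ₖ b) * ptransp N V * (a ⊗ₖ 1)ᵀ := by
  ext ⟨i, j⟩ ⟨α, β⟩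
  simp [ptransp, Matrix.mul_apply, Fintype.sum_prod_type, Matrix.one_apply, Finset.sum_mul]
  exact Finset.sum_congr rfl fun _ _ => Finset.sum_congr rfl fun _ _ => by ring

lemma trace_gram_sq_unitary_conj {n : Type*} [Fintype n] [DecidableEq n] (a b R : Matrix n n ℂ)
    (ha : aᴴ * a = 1) (hb : b * bᴴ = 1) :
    (a * R * b * (a * R * b)ᴴ * (a * R * b * (a * R * b)ᴴ)).trace
      = (R * Rᴴ * (R * Rᴴ)).trace := by
  have h : a * R * b * (a * R * b)ᴴ = a * (R * Rᴴ) * aᴴ := by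
    rw [conjTranspose_mul, conjTranspose_mul, show a * R * b * (bᴴ * (Rᴴ * aᴴ))
      = a * R * (b * bᴴ) * Rᴴ * aᴴ by simp only [Matrix.mul_assoc], hb]
    simp only [Matrix.mul_assoc, Matrix.one_mul]
  rw [h]
  generalize R * Rᴴ = T
  rw [show a * T * aᴴ * (a * T * aᴴ) = a * (T * (aᴴ * a) * T * aᴴ) by
    simp only [Matrix.mul_assoc], ha, Matrix.mul_one, trace_mul_comm, Matrix.mul_assoc, ha,
    Matrix.mul_one]

lemma conjTranspose_kronecker_mul_self {m n : Type*} [Fintype m] [DecidableEq m] [Fintype n]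
    [DecidableEq n] (a : Matrix.unitaryGroup m ℂ) (b : Matrix.unitaryGroup n ℂ) :
    ((a : Matrix m m ℂ) ⊗ₖ (b : Matrix n n ℂ))ᴴ * ((a : Matrix m m ℂ) ⊗ₖ (b : Matrix n n ℂ)) = 1 :=
  mem_unitaryGroup_iff'.1 (kronecker_mem_unitary a.2 b.2)

lemma transpose_mul_conjTranspose_transpose {n : Type*} [Fintype n] [DecidableEq n]
    {a : Matrix n n ℂ} (ha : aᴴ * a = 1) : aᵀ * aᵀᴴ = 1 := by
  rw [show aᵀᴴ = aᴴᵀ from rfl, ← transpose_mul, ha, transpose_one]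

lemma Xpur_kronecker_mul (N : ℕ) (a b : Matrix.unitaryGroup (Fin N) ℂ)
    (V : Matrix (Fin N × Fin N) (Fin N × Fin N) ℂ) :
    Xpur N ((a : Matrix (Fin N) (Fin N) ℂ) ⊗ₖ (b : Matrix (Fin N) (Fin N) ℂ) * V) = Xpur N V := by
  rw [Xpur_eq, Xpur_eq, reshuffle_kronecker_mul, trace_gram_sq_unitary_conj]
  · exact conjTranspose_kronecker_mul_self a 1
  · exact transpose_mul_conjTranspose_transpose (conjTranspose_kronecker_mul_self b 1)

lemma Ypur_kronecker_mul (N : ℕ) (a b : Matrix.unitaryGroup (Fin N) ℂ)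
    (V : Matrix (Fin N × Fin N) (Fin N × Fin N) ℂ) :
    Ypur N ((a : Matrix (Fin N) (Fin N) ℂ) ⊗ₖ (b : Matrix (Fin N) (Fin N) ℂ) * V) = Ypur N V := by
  rw [Ypur_eq, Ypur_eq, ptransp_kronecker_mul, trace_gram_sq_unitary_conj]
  · exact conjTranspose_kronecker_mul_self 1 b
  · exact transpose_mul_conjTranspose_transpose (conjTranspose_kronecker_mul_self a 1)

lemma sum_pauli_mul (D D' : Matrix (Fin 2 × Fin 2) (Fin 2 × Fin 2) ℂ) :
    D.trace * D'.trace + ∑ i, (pauli i ⊗ₖ 1 * D).trace * (pauli i ⊗ₖ 1 * D').trace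
      + ∑ i, (1 ⊗ₖ pauli i * D).trace * (1 ⊗ₖ pauli i * D').trace
      + ∑ i, ∑ j, (pauli i ⊗ₖ pauli j * D).trace * (pauli i ⊗ₖ pauli j * D').trace
      = 4 * (D * D').trace := by
  simp [trace, pauli, Matrix.mul_apply, Fintype.sum_prod_type, Fin.sum_univ_two,
    Fin.sum_univ_three, Matrix.one_apply]
  ring_nf
  simp only [Complex.I_sq]
  ring

lemma reducedEvolution_eq_trace (V P : Matrix (Fin 2 × Fin 2) (Fin 2 × Fin 2) ℂ) (l j : Fin 2) :
    reducedEvolution V P l j =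
      (P * (V * (single j l 1 ⊗ₖ (1 : Matrix (Fin 2) (Fin 2) ℂ)) * Vᴴ)).trace := by
  rw [← Matrix.mul_assoc, trace_mul_comm, ← Matrix.mul_assoc, ← Matrix.mul_assoc,
    reducedEvolution, of_apply]
  generalize Vᴴ * P * V = T
  simp [trace, Matrix.mul_apply, Fintype.sum_prod_type, Matrix.one_apply, single_apply, ite_and]

lemma sum_evolvedForm {V : Matrix (Fin 2 × Fin 2) (Fin 2 × Fin 2) ℂ} (hV : Vᴴ * V = 1) :
    evolvedForm V 1 + ∑ i, evolvedForm V (pauli i ⊗ₖ 1) + ∑ i, evolvedForm V (1 ⊗ₖ pauli i)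
      + ∑ i, ∑ j, evolvedForm V (pauli i ⊗ₖ pauli j) = 32 := by
  set D : Fin 2 → Fin 2 → Matrix (Fin 2 × Fin 2) (Fin 2 × Fin 2) ℂ := fun l j =>
    V * (single j l 1 ⊗ₖ (1 : Matrix (Fin 2) (Fin 2) ℂ)) * Vᴴ with hD
  have hDD : ∀ l j, (D l j * D j l).trace = 2 := fun l j => by
    simp only [hD]
    generalize hE : single j l (1 : ℂ) ⊗ₖ (1 : Matrix (Fin 2) (Fin 2) ℂ) = E
    generalize hF : single l j (1 : ℂ) ⊗ₖ (1 : Matrix (Fin 2) (Fin 2) ℂ) = F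
    rw [show V * E * Vᴴ * (V * F * Vᴴ) = V * (E * (Vᴴ * V) * F * Vᴴ) by
      simp only [Matrix.mul_assoc], hV, Matrix.mul_one, trace_mul_comm, Matrix.mul_assoc, hV,
      Matrix.mul_one, ← hE, ← hF, ← mul_kronecker_mul, trace_kronecker]
    simp
  have h : ∀ P, evolvedForm V P =
      (∑ l, ∑ j, (P * D l j).trace * (P * D j l).trace).re := fun P => by
    rw [evolvedForm, trace]
    simp only [diag, Matrix.mul_apply (M := reducedEvolution V P), reducedEvolution_eq_trace, hD]
  simp only [h, Matrix.one_mul, ← Complex.re_sum, ← Complex.add_re]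
  have key : ∀ l j, _ := fun l j => sum_pauli_mul (D l j) (D j l)
  simp only [hDD] at key
  rw [show (32 : ℝ) = (∑ l : Fin 2, ∑ j : Fin 2, (4 * 2 : ℂ)).re by norm_num]
  congr 1
  simp only [Fin.sum_univ_two, Fin.sum_univ_three] at key ⊢
  linear_combination key 0 0 + key 0 1 + key 1 0 + key 1 1

lemma conjTranspose_cnot_mul_cnot : cnotᴴ * cnot = 1 := by
  ext ⟨i, α⟩ ⟨j, β⟩
  fin_cases i <;> fin_cases α <;> fin_cases j <;> fin_cases β <;>
    simp [cnot, Matrix.mul_apply, Fintype.sum_prod_type]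

lemma cnot_conj_pauli_kronecker_one (i : Fin 3) : cnotᴴ * (pauli i ⊗ₖ 1) * cnot =
    ![pauli 0 ⊗ₖ pauli 0, pauli 1 ⊗ₖ pauli 0, pauli 2 ⊗ₖ 1] i := by
  ext ⟨a, α⟩ ⟨b, β⟩
  fin_cases i <;> fin_cases a <;> fin_cases α <;> fin_cases b <;> fin_cases β <;>
    simp [cnot, pauli, Matrix.mul_apply, Fintype.sum_prod_type]

lemma cnot_conj_one_kronecker_pauli (i : Fin 3) : cnotᴴ * (1 ⊗ₖ pauli i) * cnot =
    ![1 ⊗ₖ pauli 0, pauli 2 ⊗ₖ pauli 1, pauli 2 ⊗ₖ pauli 2] i := by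
  ext ⟨a, α⟩ ⟨b, β⟩
  fin_cases i <;> fin_cases a <;> fin_cases α <;> fin_cases b <;> fin_cases β <;>
    simp [cnot, pauli, Matrix.mul_apply, Fintype.sum_prod_type]

lemma Xpur_cnot_mul (V : Matrix (Fin 2 × Fin 2) (Fin 2 × Fin 2) ℂ) :
    32 * Xpur 2 (cnot * V) = evolvedForm V 1 + (evolvedForm V (pauli 0 ⊗ₖ pauli 0)
      + evolvedForm V (pauli 1 ⊗ₖ pauli 0) + evolvedForm V (pauli 2 ⊗ₖ 1)) := by
  rw [Xpur_eq_sum_evolvedForm]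
  simp [evolvedForm_mul, cnot_conj_pauli_kronecker_one, conjTranspose_cnot_mul_cnot,
    Fin.sum_univ_three]

lemma Ypur_cnot_mul (V : Matrix (Fin 2 × Fin 2) (Fin 2 × Fin 2) ℂ) :
    32 * Ypur 2 (cnot * V) = evolvedForm V 1 + (evolvedForm V (1 ⊗ₖ pauli 0)
      + evolvedForm V (pauli 2 ⊗ₖ pauli 1) + evolvedForm V (pauli 2 ⊗ₖ pauli 2)) := by
  rw [Ypur_eq_sum_evolvedForm]
  simp [evolvedForm_mul, cnot_conj_one_kronecker_pauli, conjTranspose_cnot_mul_cnot,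
    Fin.sum_univ_three]

lemma Xpur_cnot : Xpur 2 cnot = 1 / 2 := by
  simp [Xpur, rhoR, reshuffle, trace, cnot, Matrix.mul_apply, Fintype.sum_prod_type]
  norm_num

lemma Ypur_cnot : Ypur 2 cnot = 1 / 4 := by
  rw [Ypur_eq]
  simp [ptransp, trace, cnot, Matrix.mul_apply, Fintype.sum_prod_type]
  norm_num

/-- A Clifford unitary that permutes the Pauli matrices cyclically. -/
def pauliCycle : Matrix.unitaryGroup (Fin 2) ℂ :=
  ⟨!![⟨1 / 2, 1 / 2⟩, ⟨1 / 2, 1 / 2⟩; ⟨-1 / 2, 1 / 2⟩, ⟨1 / 2, -1 / 2⟩], by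
    rw [mem_unitaryGroup_iff']
    ext i j
    fin_cases i <;> fin_cases j <;> simp [Matrix.mul_apply, star_eq_conjTranspose, Complex.ext_iff]
      <;> norm_num⟩

lemma pauliCycle_conj_pauli (i : Fin 3) : (pauliCycle : Matrix (Fin 2) (Fin 2) ℂ)ᴴ * pauli i *
    (pauliCycle : Matrix (Fin 2) (Fin 2) ℂ) = pauli (i + 1) := by
  fin_cases i <;> ext a b <;> fin_cases a <;> fin_cases b <;>
    simp [Matrix.mul_apply, pauliCycle, pauli, Complex.ext_iff] <;> norm_num

instance {m n R : Type*} [Countable m] [Countable n] [TopologicalSpace R]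
    [SecondCountableTopology R] : SecondCountableTopology (Matrix m n R) :=
  inferInstanceAs (SecondCountableTopology (m → n → R))

instance {n : Type*} [Fintype n] [DecidableEq n] : CompactSpace (Matrix.unitaryGroup n ℂ) := by
  have hK : IsCompact (Set.univ.pi fun _ => Set.univ.pi fun _ => Metric.closedBall 0 1 :
      Set (n → n → ℂ)) :=
    isCompact_univ_pi fun _ => isCompact_univ_pi fun _ => isCompact_closedBall 0 1
  have hclosed : IsClosed (Matrix.unitaryGroup n ℂ : Set (Matrix n n ℂ)) := isClosed_unitary
  refine isCompact_iff_compactSpace.1 (IsCompact.of_isClosed_subset (X := Matrix n n ℂ) hK hclosed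
    fun U hU i _ j _ => ?_)
  simpa using entry_norm_bound_of_unitary hU i j

instance {n : Type*} [Fintype n] [DecidableEq n] :
    SecondCountableTopology (Matrix.unitaryGroup n ℂ) :=
  TopologicalSpace.Subtype.secondCountableTopology (Matrix.unitaryGroup n ℂ : Set (Matrix n n ℂ))

instance {n : Type*} [Fintype n] [DecidableEq n] : BorelSpace (Matrix.unitaryGroup n ℂ) :=
  inferInstanceAs (BorelSpace {U : Matrix n n ℂ // U ∈ Matrix.unitaryGroup n ℂ})

lemma Continuous.integrable_of_compactSpace {X E : Type*} [TopologicalSpace X] [CompactSpace X]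
    [MeasurableSpace X] [OpensMeasurableSpace X] [NormedAddCommGroup E]
    [SecondCountableTopologyEither X E] {ν : Measure X} [IsFiniteMeasure ν] {f : X → E}
    (hf : Continuous f) : Integrable f ν :=
  hf.integrable_of_hasCompactSupport (HasCompactSupport.of_compactSpace f)

lemma continuous_trace_gram_sq {X n : Type*} [TopologicalSpace X] [Fintype n]
    {f : X → Matrix n n ℂ} (hf : Continuous f) :
    Continuous fun x => (f x * (f x)ᴴ * (f x * (f x)ᴴ)).trace.re :=
  have h := hf.mul hf.matrix_conjTranspose
  Complex.continuous_re.comp (h.mul h).matrix_trace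

lemma continuous_Xpur (N : ℕ) : Continuous (Xpur N) := by
  simp only [funext (Xpur_eq N)]
  exact continuous_const.mul (continuous_trace_gram_sq
    (continuous_matrix fun _ _ => continuous_id.matrix_elem _ _))

lemma continuous_Ypur (N : ℕ) : Continuous (Ypur N) := by
  simp only [funext (Ypur_eq N)]
  exact continuous_const.mul (continuous_trace_gram_sq
    (continuous_matrix fun _ _ => continuous_id.matrix_elem _ _))

lemma continuous_evolvedForm (P : Matrix (Fin 2 × Fin 2) (Fin 2 × Fin 2) ℂ) :
    Continuous fun V => evolvedForm V P := by
  have hV : Continuous fun V : Matrix (Fin 2 × Fin 2) (Fin 2 × Fin 2) ℂ => Vᴴ * P * V :=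
    (continuous_id.matrix_conjTranspose.mul continuous_const).mul continuous_id
  have h : Continuous fun V => reducedEvolution V P :=
    continuous_matrix fun l j => by
      simp only [reducedEvolution, of_apply]
      exact continuous_finsetSum _ fun β _ => hV.matrix_elem (l, β) (j, β)
  exact Complex.continuous_re.comp (h.mul h).matrix_trace

/-- The product gate `a ⊗ b` attached to a pair of local unitaries. -/
def localGate (w : Matrix.unitaryGroup (Fin 2) ℂ × Matrix.unitaryGroup (Fin 2) ℂ) :
    Matrix (Fin 2 × Fin 2) (Fin 2 × Fin 2) ℂ :=
  (w.1 : Matrix (Fin 2) (Fin 2) ℂ) ⊗ₖ (w.2 : Matrix (Fin 2) (Fin 2) ℂ)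

lemma continuous_localGate : Continuous localGate := by
  refine continuous_matrix fun i j => ?_
  exact ((continuous_subtype_val.comp continuous_fst).matrix_elem _ _).mul
    ((continuous_subtype_val.comp continuous_snd).matrix_elem _ _)

lemma conjTranspose_localGate_mul_localGate
    (w : Matrix.unitaryGroup (Fin 2) ℂ × Matrix.unitaryGroup (Fin 2) ℂ) :
    (localGate w)ᴴ * localGate w = 1 :=
  conjTranspose_kronecker_mul_self w.1 w.2

lemma localGate_mul (v w : Matrix.unitaryGroup (Fin 2) ℂ × Matrix.unitaryGroup (Fin 2) ℂ) :
    localGate (v * w) = localGate v * localGate w := by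
  simp [localGate, mul_kronecker_mul]

lemma integrable_evolvedForm (μ : Measure (Matrix.unitaryGroup (Fin 2) ℂ)) [IsFiniteMeasure μ]
    (V P : Matrix (Fin 2 × Fin 2) (Fin 2 × Fin 2) ℂ) :
    Integrable (fun w => evolvedForm (localGate w * V) P) (μ.prod μ) :=
  ((continuous_evolvedForm P).comp
    (continuous_localGate.mul continuous_const)).integrable_of_compactSpace

lemma integrable_cnot_localGate_mul (μ : Measure (Matrix.unitaryGroup (Fin 2) ℂ))
    [IsFiniteMeasure μ] {f : Matrix (Fin 2 × Fin 2) (Fin 2 × Fin 2) ℂ → ℝ} (hf : Continuous f)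
    (V : Matrix (Fin 2 × Fin 2) (Fin 2 × Fin 2) ℂ) :
    Integrable (fun w => f (cnot * localGate w * V)) (μ.prod μ) :=
  (hf.comp ((continuous_const.mul continuous_localGate).mul
    continuous_const)).integrable_of_compactSpace

/-- Haar invariance: conjugating the observable by a local gate does not change its average. -/
lemma integral_evolvedForm_conj (μ : Measure (Matrix.unitaryGroup (Fin 2) ℂ))
    [μ.IsMulLeftInvariant] [SFinite μ] (V P : Matrix (Fin 2 × Fin 2) (Fin 2 × Fin 2) ℂ)
    (u : Matrix.unitaryGroup (Fin 2) ℂ × Matrix.unitaryGroup (Fin 2) ℂ) :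
    ∫ w, evolvedForm (localGate w * V) ((localGate u)ᴴ * P * localGate u) ∂μ.prod μ
      = ∫ w, evolvedForm (localGate w * V) P ∂μ.prod μ := by
  rw [← integral_mul_left_eq_self (fun w => evolvedForm (localGate w * V) P) u]
  simp only [localGate_mul, Matrix.mul_assoc, evolvedForm_mul (localGate u)]

lemma integral_evolvedForm_cycle_left (μ : Measure (Matrix.unitaryGroup (Fin 2) ℂ))
    [μ.IsMulLeftInvariant] [SFinite μ] (V : Matrix (Fin 2 × Fin 2) (Fin 2 × Fin 2) ℂ)
    (P : Matrix (Fin 2) (Fin 2) ℂ) (i : Fin 3) :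
    ∫ w, evolvedForm (localGate w * V) (pauli i ⊗ₖ P) ∂μ.prod μ
      = ∫ w, evolvedForm (localGate w * V) (pauli 0 ⊗ₖ P) ∂μ.prod μ := by
  have h : ∀ i, ∫ w, evolvedForm (localGate w * V) (pauli (i + 1) ⊗ₖ P) ∂μ.prod μ
      = ∫ w, evolvedForm (localGate w * V) (pauli i ⊗ₖ P) ∂μ.prod μ := fun i => by
    rw [← integral_evolvedForm_conj μ V (pauli i ⊗ₖ P) (pauliCycle, 1)]
    simp [localGate, conjTranspose_kronecker, ← mul_kronecker_mul, pauliCycle_conj_pauli]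
  fin_cases i
  · rfl
  · exact h 0
  · exact (h 1).trans (h 0)

lemma integral_evolvedForm_cycle_right (μ : Measure (Matrix.unitaryGroup (Fin 2) ℂ))
    [μ.IsMulLeftInvariant] [SFinite μ] (V : Matrix (Fin 2 × Fin 2) (Fin 2 × Fin 2) ℂ)
    (P : Matrix (Fin 2) (Fin 2) ℂ) (i : Fin 3) :
    ∫ w, evolvedForm (localGate w * V) (P ⊗ₖ pauli i) ∂μ.prod μ
      = ∫ w, evolvedForm (localGate w * V) (P ⊗ₖ pauli 0) ∂μ.prod μ := by
  have h : ∀ i, ∫ w, evolvedForm (localGate w * V) (P ⊗ₖ pauli (i + 1)) ∂μ.prod μ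
      = ∫ w, evolvedForm (localGate w * V) (P ⊗ₖ pauli i) ∂μ.prod μ := fun i => by
    rw [← integral_evolvedForm_conj μ V (P ⊗ₖ pauli i) (1, pauliCycle)]
    simp [localGate, conjTranspose_kronecker, ← mul_kronecker_mul, pauliCycle_conj_pauli]
  fin_cases i
  · rfl
  · exact h 0
  · exact (h 1).trans (h 0)

section LocalAverage

variable (μ : Measure (Matrix.unitaryGroup (Fin 2) ℂ)) [μ.IsHaarMeasure] [IsProbabilityMeasure μ]

variable {V : Matrix (Fin 2 × Fin 2) (Fin 2 × Fin 2) ℂ}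

lemma conjTranspose_localGate_mul_mul (hV : Vᴴ * V = 1)
    (w : Matrix.unitaryGroup (Fin 2) ℂ × Matrix.unitaryGroup (Fin 2) ℂ) :
    (localGate w * V)ᴴ * (localGate w * V) = 1 := by
  rw [conjTranspose_mul, Matrix.mul_assoc, ← Matrix.mul_assoc (localGate w)ᴴ,
    conjTranspose_localGate_mul_localGate, Matrix.one_mul, hV]

lemma integral_evolvedForm_pauli_one (hV : Vᴴ * V = 1) (i : Fin 3) :
    ∫ w, evolvedForm (localGate w * V) (pauli i ⊗ₖ 1) ∂μ.prod μ = (32 * Xpur 2 V - 8) / 3 := by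
  have h : ∑ i, ∫ w, evolvedForm (localGate w * V) (pauli i ⊗ₖ 1) ∂μ.prod μ
      = 32 * Xpur 2 V - 8 := by
    rw [← integral_finsetSum _ fun _ _ => integrable_evolvedForm μ V _]
    have : ∀ w, ∑ i, evolvedForm (localGate w * V) (pauli i ⊗ₖ 1) = 32 * Xpur 2 V - 8 :=
      fun w => by
        have h₁ := Xpur_eq_sum_evolvedForm (localGate w * V)
        rw [evolvedForm_one (conjTranspose_localGate_mul_mul hV w), localGate,
          Xpur_kronecker_mul] at h₁
        rw [localGate]
        linarith
    simp [this]
  simp only [integral_evolvedForm_cycle_left μ V 1, Fin.sum_univ_three] at h ⊢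
  linarith

lemma integral_evolvedForm_one_pauli (hV : Vᴴ * V = 1) (i : Fin 3) :
    ∫ w, evolvedForm (localGate w * V) (1 ⊗ₖ pauli i) ∂μ.prod μ = (32 * Ypur 2 V - 8) / 3 := by
  have h : ∑ i, ∫ w, evolvedForm (localGate w * V) (1 ⊗ₖ pauli i) ∂μ.prod μ
      = 32 * Ypur 2 V - 8 := by
    rw [← integral_finsetSum _ fun _ _ => integrable_evolvedForm μ V _]
    have : ∀ w, ∑ i, evolvedForm (localGate w * V) (1 ⊗ₖ pauli i) = 32 * Ypur 2 V - 8 :=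
      fun w => by
        have h₁ := Ypur_eq_sum_evolvedForm (localGate w * V)
        rw [evolvedForm_one (conjTranspose_localGate_mul_mul hV w), localGate,
          Ypur_kronecker_mul] at h₁
        rw [localGate]
        linarith
    simp [this]
  simp only [integral_evolvedForm_cycle_right μ V 1, Fin.sum_univ_three] at h ⊢
  linarith

lemma integral_evolvedForm_pauli_pauli (hV : Vᴴ * V = 1) (i j : Fin 3) :
    ∫ w, evolvedForm (localGate w * V) (pauli i ⊗ₖ pauli j) ∂μ.prod μ
      = (40 - 32 * (Xpur 2 V + Ypur 2 V)) / 9 := by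
  have h : ∑ i, ∑ j, ∫ w, evolvedForm (localGate w * V) (pauli i ⊗ₖ pauli j) ∂μ.prod μ
      = 40 - 32 * (Xpur 2 V + Ypur 2 V) := by
    simp only [← integral_finsetSum _ fun _ _ => integrable_evolvedForm μ V _]
    rw [← integral_finsetSum _ fun _ _ =>
      integrable_finsetSum _ fun _ _ => integrable_evolvedForm μ V _]
    have : ∀ w, ∑ i, ∑ j, evolvedForm (localGate w * V) (pauli i ⊗ₖ pauli j)
        = 40 - 32 * (Xpur 2 V + Ypur 2 V) := fun w => by
      have hw := conjTranspose_localGate_mul_mul hV w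
      have h₁ := Xpur_eq_sum_evolvedForm (localGate w * V)
      have h₂ := Ypur_eq_sum_evolvedForm (localGate w * V)
      have h₃ := sum_evolvedForm hw
      rw [evolvedForm_one hw] at h₁ h₂ h₃
      rw [show Xpur 2 (localGate w * V) = Xpur 2 V from Xpur_kronecker_mul 2 w.1 w.2 V] at h₁
      rw [show Ypur 2 (localGate w * V) = Ypur 2 V from Ypur_kronecker_mul 2 w.1 w.2 V] at h₂
      linarith
    simp [this]
  simp only [fun i j => integral_evolvedForm_cycle_left μ V (pauli j) i,
    integral_evolvedForm_cycle_right μ V (pauli 0), Fin.sum_univ_three] at h ⊢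
  linarith

lemma integral_Xpur_cnot_localGate_mul (hV : Vᴴ * V = 1) :
    ∫ w, Xpur 2 (cnot * localGate w * V) ∂μ.prod μ
      = (8 + 2 * ((40 - 32 * (Xpur 2 V + Ypur 2 V)) / 9) + (32 * Xpur 2 V - 8) / 3) / 32 := by
  have h : ∀ w, Xpur 2 (cnot * localGate w * V) = (8 +
      (evolvedForm (localGate w * V) (pauli 0 ⊗ₖ pauli 0)
        + evolvedForm (localGate w * V) (pauli 1 ⊗ₖ pauli 0)
        + evolvedForm (localGate w * V) (pauli 2 ⊗ₖ 1))) / 32 := fun w => by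
    rw [← evolvedForm_one (conjTranspose_localGate_mul_mul hV w), ← Xpur_cnot_mul,
      Matrix.mul_assoc]
    ring
  have hi := integrable_evolvedForm μ V
  simp only [h]
  rw [integral_div, integral_add (by fun_prop) (by fun_prop),
    integral_add (by fun_prop) (hi _), integral_add (hi _) (hi _),
    integral_evolvedForm_pauli_pauli μ hV, integral_evolvedForm_pauli_pauli μ hV,
    integral_evolvedForm_pauli_one μ hV]
  simp
  ring

lemma integral_Ypur_cnot_localGate_mul (hV : Vᴴ * V = 1) :
    ∫ w, Ypur 2 (cnot * localGate w * V) ∂μ.prod μ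
      = (8 + 2 * ((40 - 32 * (Xpur 2 V + Ypur 2 V)) / 9) + (32 * Ypur 2 V - 8) / 3) / 32 := by
  have h : ∀ w, Ypur 2 (cnot * localGate w * V) = (8 +
      (evolvedForm (localGate w * V) (1 ⊗ₖ pauli 0)
        + evolvedForm (localGate w * V) (pauli 2 ⊗ₖ pauli 1)
        + evolvedForm (localGate w * V) (pauli 2 ⊗ₖ pauli 2))) / 32 := fun w => by
    rw [← evolvedForm_one (conjTranspose_localGate_mul_mul hV w), ← Ypur_cnot_mul,
      Matrix.mul_assoc]
    ring
  have hi := integrable_evolvedForm μ V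
  simp only [h]
  rw [integral_div, integral_add (by fun_prop) (by fun_prop),
    integral_add (by fun_prop) (hi _), integral_add (hi _) (hi _),
    integral_evolvedForm_pauli_pauli μ hV, integral_evolvedForm_pauli_pauli μ hV,
    integral_evolvedForm_one_pauli μ hV]
  simp
  ring

lemma integral_one_sub_ep (hV : Vᴴ * V = 1) :
    ∫ w, (1 - 5 * ep 2 (cnot * localGate w * V)) ∂μ.prod μ = (-1 / 9) * (1 - 5 * ep 2 V) := by
  have h : ∀ U, 1 - 5 * ep 2 U = 20 / 9 * (Xpur 2 U + Ypur 2 U) - 16 / 9 := fun U => by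
    norm_num [ep]
    ring
  have hX := integrable_cnot_localGate_mul μ (continuous_Xpur 2) V
  have hY := integrable_cnot_localGate_mul μ (continuous_Ypur 2) V
  simp only [h]
  rw [integral_sub (by fun_prop) (by fun_prop), integral_const_mul,
    integral_add hX hY, integral_Xpur_cnot_localGate_mul μ hV,
    integral_Ypur_cnot_localGate_mul μ hV]
  simp
  ring

lemma integral_one_sub_gateTyp (hV : Vᴴ * V = 1) :
    ∫ w, (1 - gateTyp 2 (cnot * localGate w * V)) ∂μ.prod μ = (1 / 3) * (1 - gateTyp 2 V) := by
  have h : ∀ U, 1 - gateTyp 2 U = 4 / 3 * (Xpur 2 U - Ypur 2 U) := fun U => by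
    norm_num [gateTyp]
    ring
  have hX := integrable_cnot_localGate_mul μ (continuous_Xpur 2) V
  have hY := integrable_cnot_localGate_mul μ (continuous_Ypur 2) V
  simp only [h]
  rw [integral_const_mul, integral_sub hX hY, integral_Xpur_cnot_localGate_mul μ hV,
    integral_Ypur_cnot_localGate_mul μ hV]
  ring

/-- The gate sequence `W_0, …, W_{k-1}` given by `k` pairs of local unitaries. -/
def localGateSeq {k : ℕ}
    (g : Fin k → Matrix.unitaryGroup (Fin 2) ℂ × Matrix.unitaryGroup (Fin 2) ℂ) (j : ℕ) :
    Matrix (Fin 2 × Fin 2) (Fin 2 × Fin 2) ℂ :=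
  if h : j < k then localGate (g ⟨j, h⟩) else 1

lemma iterGate_congr {D : Type*} [Fintype D] [DecidableEq D] (U : Matrix D D ℂ)
    {W W' : ℕ → Matrix D D ℂ} {k : ℕ} (h : ∀ j < k, W j = W' j) :
    iterGate U W k = iterGate U W' k := by
  induction k with
  | zero => rfl
  | succ k ih =>
    rw [iterGate, iterGate, h k k.lt_succ_self, ih fun j hj => h j (hj.trans k.lt_succ_self)]

lemma conjTranspose_iterGate_mul_iterGate {D : Type*} [Fintype D] [DecidableEq D]
    {U : Matrix D D ℂ} {W : ℕ → Matrix D D ℂ} (hU : Uᴴ * U = 1) (hW : ∀ j, (W j)ᴴ * W j = 1)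
    (k : ℕ) : (iterGate U W k)ᴴ * iterGate U W k = 1 := by
  simp only [← star_eq_conjTranspose, ← mem_unitaryGroup_iff'] at *
  induction k with
  | zero => exact hU
  | succ k ih => exact mul_mem (mul_mem hU (hW k)) ih

lemma conjTranspose_localGateSeq_mul {k : ℕ}
    (g : Fin k → Matrix.unitaryGroup (Fin 2) ℂ × Matrix.unitaryGroup (Fin 2) ℂ) (j : ℕ) :
    (localGateSeq g j)ᴴ * localGateSeq g j = 1 := by
  unfold localGateSeq
  split_ifs
  · exact conjTranspose_localGate_mul_localGate _
  · simp

lemma continuous_iterGate_localGateSeq (U : Matrix (Fin 2 × Fin 2) (Fin 2 × Fin 2) ℂ) (m k : ℕ) :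
    Continuous fun g : Fin k → Matrix.unitaryGroup (Fin 2) ℂ × Matrix.unitaryGroup (Fin 2) ℂ =>
      iterGate U (localGateSeq g) m := by
  induction m with
  | zero => exact continuous_const
  | succ m ih =>
    refine (continuous_const.mul ?_).mul ih
    unfold localGateSeq
    split_ifs with h
    · exact continuous_localGate.comp (continuous_apply _)
    · exact continuous_const

lemma iterGate_localGateSeq_insertNth {k : ℕ} (U : Matrix (Fin 2 × Fin 2) (Fin 2 × Fin 2) ℂ)
    (w : Matrix.unitaryGroup (Fin 2) ℂ × Matrix.unitaryGroup (Fin 2) ℂ)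
    (g : Fin k → Matrix.unitaryGroup (Fin 2) ℂ × Matrix.unitaryGroup (Fin 2) ℂ) :
    iterGate U (localGateSeq ((Fin.last k).insertNth (α := fun _ => _) w g)) (k + 1)
      = U * localGate w * iterGate U (localGateSeq g) k := by
  rw [iterGate]
  congr 1
  · rw [localGateSeq, dif_pos k.lt_succ_self]
    congr 2
    exact Fin.insertNth_apply_same (α := fun _ => _) (Fin.last k) w g
  · refine iterGate_congr U fun j hj => ?_
    rw [localGateSeq, localGateSeq, dif_pos (hj.trans k.lt_succ_self), dif_pos hj,
      Fin.insertNth_last']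
    congr 1
    exact Fin.snoc_castSucc (α := fun _ => _) w g ⟨j, hj⟩

/-- A quantity contracted by a factor `c` by each averaged step decays like `c ^ k`. -/
lemma integral_iterGate_cnot {f : Matrix (Fin 2 × Fin 2) (Fin 2 × Fin 2) ℂ → ℝ}
    (hf : Continuous f) (c : ℝ)
    (hc : ∀ V, Vᴴ * V = 1 → ∫ w, f (cnot * localGate w * V) ∂μ.prod μ = c * f V) (k : ℕ) :
    ∫ g : Fin k → Matrix.unitaryGroup (Fin 2) ℂ × Matrix.unitaryGroup (Fin 2) ℂ,
      f (iterGate cnot (localGateSeq g) k) ∂(Measure.pi fun _ => μ.prod μ) = c ^ k * f cnot := by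
  induction k with
  | zero => simp [iterGate]
  | succ k ih =>
    have hmp := (measurePreserving_piFinSuccAbove (fun _ : Fin (k + 1) => μ.prod μ)
      (Fin.last k)).symm
    have hcont : Continuous fun p :
        (Matrix.unitaryGroup (Fin 2) ℂ × Matrix.unitaryGroup (Fin 2) ℂ) ×
        (Fin k → Matrix.unitaryGroup (Fin 2) ℂ × Matrix.unitaryGroup (Fin 2) ℂ) =>
        f (cnot * localGate p.1 * iterGate cnot (localGateSeq p.2) k) :=
      hf.comp ((continuous_const.mul (continuous_localGate.comp continuous_fst)).mul
        ((continuous_iterGate_localGateSeq cnot k k).comp continuous_snd))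
    rw [← hmp.integral_comp']
    simp only [MeasurableEquiv.piFinSuccAbove_symm_apply, Fin.insertNthEquiv, Equiv.coe_fn_mk,
      iterGate_localGateSeq_insertNth]
    rw [integral_prod_symm _ hcont.integrable_of_compactSpace]
    simp only [hc _ (conjTranspose_iterGate_mul_iterGate conjTranspose_cnot_mul_cnot
      (conjTranspose_localGateSeq_mul _) k)]
    rw [integral_const_mul, ih]
    ring

end LocalAverage

/-- For the CNOT gate: `X = 1/2`, `Y = 1/4`, `e_p = 2/9`, `g_t = 2/3`,
and for every `n ≥ 1` the averages over independent Haar-random interlacing local gates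
satisfy `⟨e_p(U^(n))⟩ = (1/5)(1 - (-1)^n/9^n)` and `⟨g_t(U^(n))⟩ = 1 - 3^{-n}`. -/
theorem cnot_entangling_power_and_typicality
    (μ : Measure (Matrix.unitaryGroup (Fin 2) ℂ)) [μ.IsHaarMeasure] [IsProbabilityMeasure μ] :
    Xpur 2 cnot = 1 / 2 ∧ Ypur 2 cnot = 1 / 4 ∧
    ep 2 cnot = 2 / 9 ∧ gateTyp 2 cnot = 2 / 3 ∧
    ∀ n : ℕ, 1 ≤ n →
      (∫ g : Fin (n - 1) → Matrix.unitaryGroup (Fin 2) ℂ × Matrix.unitaryGroup (Fin 2) ℂ,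
          ep 2 (iterGate cnot
            (fun k => if h : k < n - 1 then
                ((g ⟨k, h⟩).1 : Matrix (Fin 2) (Fin 2) ℂ) ⊗ₖ
                  ((g ⟨k, h⟩).2 : Matrix (Fin 2) (Fin 2) ℂ)
              else 1) (n - 1))
          ∂(Measure.pi fun _ => μ.prod μ))
        = (1 / 5) * (1 - (-1 : ℝ) ^ n / 9 ^ n) ∧
      (∫ g : Fin (n - 1) → Matrix.unitaryGroup (Fin 2) ℂ × Matrix.unitaryGroup (Fin 2) ℂ,
          gateTyp 2 (iterGate cnot
            (fun k => if h : k < n - 1 then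
                ((g ⟨k, h⟩).1 : Matrix (Fin 2) (Fin 2) ℂ) ⊗ₖ
                  ((g ⟨k, h⟩).2 : Matrix (Fin 2) (Fin 2) ℂ)
              else 1) (n - 1))
          ∂(Measure.pi fun _ => μ.prod μ))
        = 1 - (1 / 3 : ℝ) ^ n := by
  have hep : ep 2 cnot = 2 / 9 := by norm_num [ep, Xpur_cnot, Ypur_cnot]
  have hgt : gateTyp 2 cnot = 2 / 3 := by norm_num [gateTyp, Xpur_cnot, Ypur_cnot]
  have cep : Continuous (ep 2) := by
    have := continuous_Xpur 2
    have := continuous_Ypur 2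
    unfold ep
    fun_prop
  have cgt : Continuous (gateTyp 2) := by
    have := continuous_Xpur 2
    have := continuous_Ypur 2
    unfold gateTyp
    fun_prop
  refine ⟨Xpur_cnot, Ypur_cnot, hep, hgt, fun n hn => ?_⟩
  obtain ⟨k, rfl⟩ : ∃ k, n = k + 1 := ⟨n - 1, by omega⟩
  have iep := integral_iterGate_cnot μ (f := fun V => 1 - 5 * ep 2 V) (by fun_prop) (-1 / 9)
    (fun V hV => integral_one_sub_ep μ hV) k
  have igt := integral_iterGate_cnot μ (f := fun V => 1 - gateTyp 2 V) (by fun_prop) (1 / 3)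
    (fun V hV => integral_one_sub_gateTyp μ hV) k
  have hU := continuous_iterGate_localGateSeq cnot k k
  have jep := (cep.comp hU).integrable_of_compactSpace (ν := Measure.pi fun _ => μ.prod μ)
  have jgt := (cgt.comp hU).integrable_of_compactSpace (ν := Measure.pi fun _ => μ.prod μ)
  simp only [Function.comp_def] at jep jgt
  rw [integral_sub (by fun_prop) (jep.const_mul 5), integral_const_mul, hep] at iep
  rw [integral_sub (by fun_prop) jgt, hgt] at igt
  simp only [integral_const, probReal_univ, one_smul] at iep igt
  constructor
  · refine Eq.trans (b := ∫ g : Fin k → unitaryGroup (Fin 2) ℂ × unitaryGroup (Fin 2) ℂ,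
      ep 2 (iterGate cnot (localGateSeq g) k) ∂Measure.pi fun _ => μ.prod μ) rfl ?_
    rw [← div_pow, pow_succ]
    linarith
  · refine Eq.trans (b := ∫ g : Fin k → unitaryGroup (Fin 2) ℂ × unitaryGroup (Fin 2) ℂ,
      gateTyp 2 (iterGate cnot (localGateSeq g) k) ∂Measure.pi fun _ => μ.prod μ) rfl ?_
    rw [pow_succ]
    linarith
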